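/- Let F be a positive integer and let p be the least positive integer that does not divide F. Then min{g(S) : S ∈ Sat(F)} = F − ⌊F/p⌋. -/

import Mathlib

/-- A numerical semigroup: subset of ℕ containing 0, closed under addition,
with finite complement. -/
def IsNumericalSemigroup (S : Set ℕ) : Prop :=
  0 ∈ S ∧ (∀ a ∈ S, ∀ b ∈ S, a + b ∈ S) ∧ Sᶜ.Finite

/-- `dOf S s = gcd {x ∈ S : x ≤ s}`. -/
noncomputable def dOf (S : Set ℕ) (s : ℕ) : ℕ :=
  letI := Classical.decPred (· ∈ S)
  ((Finset.range (s + 1)).filter (· ∈ S)).gcd id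

/-- A saturated numerical semigroup. -/
def IsSaturatedNS (S : Set ℕ) : Prop :=
  IsNumericalSemigroup S ∧ ∀ s ∈ S, s ≠ 0 → s + dOf S s ∈ S

/-- `Sat F`: saturated numerical semigroups with Frobenius number `F`. -/
def SatF (F : ℕ) : Set (Set ℕ) :=
  {S | IsSaturatedNS S ∧ F ∉ S ∧ ∀ x, x ∉ S → x ≤ F}

/-- Multiplicity: least nonzero element. -/
noncomputable def multOf (S : Set ℕ) : ℕ := sInf {x | x ∈ S ∧ x ≠ 0}

/-- Pseudo-Frobenius numbers. -/
def PFset (S : Set ℕ) : Set ℕ := {z | z ∉ S ∧ ∀ s ∈ S, s ≠ 0 → z + s ∈ S}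

/-- Special gaps. -/
def SGset (S : Set ℕ) : Set ℕ := {x | x ∈ PFset S ∧ 2 * x ∈ S}

/-- `TSet a b = ⟨a⟩ ∪ {x : x ≥ b}`. -/
def TSet (a b : ℕ) : Set ℕ := {x | a ∣ x} ∪ {x | b ≤ x}

/-- A `Sat(F)`-set. -/
def SatFSet (F : ℕ) (X : Set ℕ) : Prop :=
  X ∩ ({0} ∪ {x | F + 1 ≤ x}) = ∅ ∧ ∃ S ∈ SatF F, X ⊆ S

/-- `Sat(F)[X]`: intersection of all elements of `Sat F` containing `X`. -/
def SatClosure (F : ℕ) (X : Set ℕ) : Set ℕ := ⋂₀ {S | S ∈ SatF F ∧ X ⊆ S}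

/-- `X` is a minimal `Sat(F)`-system of generators of `S`. -/
def IsMinSatGen (F : ℕ) (X S : Set ℕ) : Prop :=
  SatFSet F X ∧ SatClosure F X = S ∧ ∀ Y : Set ℕ, Y ⊂ X → SatClosure F Y ≠ S

/-- The `Sat(F)`-rank of `S`: minimal cardinality of a `Sat(F)`-set `X`
with `Sat(F)[X] = S`. -/
noncomputable def SatRank (F : ℕ) (S : Set ℕ) : ℕ :=
  sInf {k | ∃ X : Set ℕ, SatFSet F X ∧ SatClosure F X = S ∧ X.ncard = k}

theorem dOf_dvd {S : Set ℕ} {s x : ℕ} (hx : x ∈ S) (hxs : x ≤ s) : dOf S s ∣ x := by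
  classical
  unfold dOf
  exact Finset.gcd_dvd (f := id) (by simp [hx]; omega)

theorem dvd_dOf {S : Set ℕ} {s d : ℕ} (h : ∀ x ∈ S, x ≤ s → d ∣ x) : d ∣ dOf S s := by
  classical
  unfold dOf
  refine Finset.dvd_gcd fun x hx => ?_
  simp only [Finset.mem_filter, Finset.mem_range] at hx
  exact h x hx.2 (by omega)

open Classical in
/-- The gaps and the positive elements up to the Frobenius number partition `{1, …, F}`. -/
theorem ncard_compl_add_card_of_mem_SatF {F : ℕ} {S : Set ℕ} (hS : S ∈ SatF F) :
    Sᶜ.ncard + ((Finset.Ioc 0 F).filter (· ∈ S)).card = F := by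
  obtain ⟨⟨⟨h0, -, -⟩, -⟩, -, hle⟩ := hS
  have h : Sᶜ = ((Finset.Ioc 0 F).filter (¬ · ∈ S) : Finset ℕ) := by
    ext x
    simp only [Set.mem_compl_iff, Finset.coe_filter, Finset.mem_Ioc, Set.mem_ofPred_eq]
    refine ⟨fun hx => ⟨⟨Nat.pos_of_ne_zero ?_, hle x hx⟩, hx⟩, fun hx => hx.2⟩
    rintro rfl
    exact hx h0
  rw [h, Set.ncard_coe_finset, add_comm, Finset.card_filter_add_card_filter_not, Nat.card_Ioc,
    Nat.sub_zero]

theorem TSet_mem_SatF {F p : ℕ} (hpF : ¬ p ∣ F) : TSet p (F + 1) ∈ SatF F := by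
  refine ⟨⟨⟨Or.inl (dvd_zero p), ?_, ?_⟩, ?_⟩, ?_, ?_⟩
  · rintro a (ha | ha) b (hb | hb)
    · exact Or.inl (dvd_add ha hb)
    all_goals
      right
      simp only [Set.mem_ofPred_eq] at *
      omega
  · refine (Set.finite_Iic F).subset fun x hx => ?_
    by_contra h
    exact hx (Or.inr (Nat.succ_le_of_lt (not_le.1 h)))
  · intro s hs _
    by_cases hsF : F + 1 ≤ s
    · exact Or.inr (hsF.trans (Nat.le_add_right _ _))
    · have hdvd : ∀ x ∈ TSet p (F + 1), x ≤ s → p ∣ x := by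
        rintro x (hx | hx) hxs
        · exact hx
        · exact absurd (le_trans hx hxs) hsF
      exact Or.inl (dvd_add (hdvd s hs le_rfl) (dvd_dOf hdvd))
  · rintro (h | h)
    · exact hpF h
    · exact absurd h (Nat.not_succ_le_self F)
  · intro x hx
    by_contra h
    exact hx (Or.inr (Nat.succ_le_of_lt (not_le.1 h)))

open Classical in
/-- The positive elements of `S ∈ Sat F` below `F` are multiples of some `d` not dividing `F`. -/
theorem card_filter_le_div_of_mem_SatF {F p : ℕ} (hp : 0 < p)
    (hpmin : ∀ q, 0 < q → ¬ q ∣ F → p ≤ q) {S : Set ℕ} (hS : S ∈ SatF F) :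
    ((Finset.Ioc 0 F).filter (· ∈ S)).card ≤ F / p := by
  obtain ⟨⟨-, hsat⟩, hFS, -⟩ := hS
  set A := (Finset.Ioc 0 F).filter (· ∈ S) with hA
  have memA : ∀ x, x ∈ A ↔ (0 < x ∧ x ≤ F) ∧ x ∈ S := by simp [hA]
  rcases A.eq_empty_or_nonempty with h | hne
  · simp [h]
  obtain ⟨⟨ht0, htF⟩, htS⟩ := (memA _).1 (A.max'_mem hne)
  have hmax : ∀ x ∈ A, x ≤ A.max' hne := fun x hx => A.le_max' x hx
  generalize A.max' hne = t at *
  have hdt : dOf S t ∣ t := dOf_dvd htS le_rfl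
  have hd0 : 0 < dOf S t := Nat.pos_of_dvd_of_pos hdt ht0
  have hlt : t < F := lt_of_le_of_ne htF fun h => hFS (h ▸ htS)
  have hdF : ¬ dOf S t ∣ F := by
    intro h
    have := Nat.le_of_dvd (Nat.sub_pos_of_lt hlt) (Nat.dvd_sub h hdt)
    have := hmax _ ((memA _).2 ⟨⟨by omega, by omega⟩, hsat t htS ht0.ne'⟩)
    omega
  calc A.card ≤ ((Finset.Ioc 0 F).filter (dOf S t ∣ ·)).card := by
        refine Finset.card_le_card fun x hx => ?_
        have hx' := (memA x).1 hx
        simp only [Finset.mem_filter, Finset.mem_Ioc]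
        exact ⟨hx'.1, dOf_dvd hx'.2 (hmax x hx)⟩
    _ = F / dOf S t := Nat.Ioc_filter_dvd_card_eq_div _ _
    _ ≤ F / p := Nat.div_le_div_left (hpmin _ hd0 hdF) hp

/-- if `p` is the least positive integer not dividing `F`, then
`min {g(S) : S ∈ Sat(F)} = F - ⌊F/p⌋`. -/
theorem min_genus_SatF (F : ℕ) (hF : 0 < F) (p : ℕ) (hp : 0 < p)
    (hpF : ¬ p ∣ F) (hpmin : ∀ q, 0 < q → ¬ q ∣ F → p ≤ q) :
    IsLeast {g | ∃ S ∈ SatF F, Sᶜ.ncard = g} (F - F / p) := by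
  classical
  constructor
  · have hT := TSet_mem_SatF hpF
    refine ⟨_, hT, ?_⟩
    have h := ncard_compl_add_card_of_mem_SatF hT
    have hcard : ((Finset.Ioc 0 F).filter (· ∈ TSet p (F + 1))).card = F / p := by
      rw [← Nat.Ioc_filter_dvd_card_eq_div]
      congr 1
      refine Finset.filter_congr fun x hx => ⟨?_, Or.inl⟩
      rintro (h | h)
      · exact h
      · exact absurd ((Finset.mem_Ioc.1 hx).2) (not_le.2 h)
    omega
  · rintro _ ⟨S, hS, rfl⟩
    have h := ncard_compl_add_card_of_mem_SatF hS
    have h' := card_filter_le_div_of_mem_SatF hp hpmin hS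
    omega
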